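/- Define a relation ∼ on Δ^{S_4}_{(2)} × {1, 2, 3, 4} by (x, i) ∼ (y, j) if and only if x = y and there exist g_0 < … < g_l in S_4 with x ∈ D_{g_0,…,g_l} and with i and j lying in the same orbit of the subgroup of S_4 generated by g_0⁻¹g_1, …, g_0⁻¹g_l. Then ∼ is an equivalence relation, and the set {((x,i),(y,j)) : (x,i) ∼ (y,j)} is a closed subset of (Δ^{S_4}_{(2)} × {1,2,3,4})². -/

import Mathlib

/-- `i` and `j` lie in the same orbit of the subgroup `G` of `S_n`. -/
def sameOrbit {n : ℕ} (G : Subgroup (Equiv.Perm (Fin n))) (i j : Fin n) : Prop :=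
  ∃ p ∈ G, p i = j

/-- The subgroup of `S_n` generated by the differences `g⁻¹ * h` of elements of `S`;
for `S = {g₀, …, g_l}` it is the subgroup generated by `g₀⁻¹g₁, …, g₀⁻¹g_l`. -/
def groupOf {n : ℕ} (S : Finset (Equiv.Perm (Fin n))) : Subgroup (Equiv.Perm (Fin n)) :=
  Subgroup.closure {q | ∃ g ∈ S, ∃ h ∈ S, q = g⁻¹ * h}

/-- The `k`-skeleton `Δ^{S_n}_{(k)}` of the simplex with vertices indexed by `S_n`:
points of the simplex with at most `k+1` nonzero coordinates. -/
def skel (n k : ℕ) : Set (Equiv.Perm (Fin n) → ℝ) :=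
  {x | (∀ g, 0 ≤ x g) ∧ (∑ g, x g) = 1 ∧
    (Finset.univ.filter fun g => x g ≠ 0).card ≤ k + 1}

/-- The relation `∼` on `Δ^{S₄}_{(2)} × {1,2,3,4}`: `(x, i) ∼ (y, j)` iff `x = y` and
there is a nonempty `S = {g₀, …, g_l} ⊆ S₄` with `x ∈ D_S` (all coordinates `x_g`, `g ∈ S`,
at least `1/4`) such that `i` and `j` lie in the same orbit of the subgroup generated by
the `g₀⁻¹gᵢ`. -/
def SimRel (p q : ↥(skel 4 2) × Fin 4) : Prop :=
  p.1 = q.1 ∧ ∃ S : Finset (Equiv.Perm (Fin 4)), S.Nonempty ∧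
    (∀ g ∈ S, 1 / 4 ≤ (p.1 : Equiv.Perm (Fin 4) → ℝ) g) ∧
    sameOrbit (groupOf S) p.2 q.2

theorem sameOrbit.refl {n : ℕ} (G : Subgroup (Equiv.Perm (Fin n))) (i : Fin n) :
    sameOrbit G i i :=
  ⟨1, G.one_mem, rfl⟩

theorem sameOrbit.symm {n : ℕ} {G : Subgroup (Equiv.Perm (Fin n))} {i j : Fin n}
    (h : sameOrbit G i j) : sameOrbit G j i := by
  obtain ⟨p, hp, rfl⟩ := h
  exact ⟨p⁻¹, G.inv_mem hp, by simp⟩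

theorem sameOrbit.trans {n : ℕ} {G : Subgroup (Equiv.Perm (Fin n))} {i j k : Fin n}
    (h₁ : sameOrbit G i j) (h₂ : sameOrbit G j k) : sameOrbit G i k := by
  obtain ⟨p, hp, rfl⟩ := h₁
  obtain ⟨q, hq, rfl⟩ := h₂
  exact ⟨q * p, G.mul_mem hq hp, rfl⟩

theorem sameOrbit.mono {n : ℕ} {G H : Subgroup (Equiv.Perm (Fin n))} (hGH : G ≤ H)
    {i j : Fin n} (h : sameOrbit G i j) : sameOrbit H i j := by
  obtain ⟨p, hp, hij⟩ := h
  exact ⟨p, hGH hp, hij⟩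

theorem groupOf_mono {n : ℕ} {S T : Finset (Equiv.Perm (Fin n))} (h : S ⊆ T) :
    groupOf S ≤ groupOf T :=
  Subgroup.closure_mono fun _ ⟨a, ha, b, hb, hq⟩ => ⟨a, h ha, b, h hb, hq⟩

/-- A point of the `k`-skeleton has a coordinate that is at least `1 / (k + 1)`. -/
theorem exists_one_div_le_of_mem_skel {n k : ℕ} {x : Equiv.Perm (Fin n) → ℝ}
    (hx : x ∈ skel n k) : ∃ g, 1 / ((k : ℝ) + 1) ≤ x g := by
  obtain ⟨-, hsum, hcard⟩ := hx
  by_contra! hlt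
  have hk : (0 : ℝ) < k + 1 := by positivity
  set s := Finset.univ.filter fun g => x g ≠ 0
  have hs : ∑ g ∈ s, x g = 1 := (Finset.sum_filter_ne_zero _).trans hsum
  have hne : s.Nonempty := Finset.nonempty_of_sum_ne_zero (hs.trans_ne one_ne_zero)
  have hsum_lt : ∑ g ∈ s, x g < ∑ _g ∈ s, 1 / ((k : ℝ) + 1) :=
    Finset.sum_lt_sum_of_nonempty hne fun g _ => hlt g
  rw [hs, Finset.sum_const, nsmul_eq_mul, mul_one_div, lt_div_iff₀ hk, one_mul] at hsum_lt
  exact absurd hsum_lt (not_lt.mpr (by exact_mod_cast hcard))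

theorem simRel_equivalence : Equivalence SimRel where
  refl p := by
    obtain ⟨g, hg⟩ := exists_one_div_le_of_mem_skel p.1.2
    refine ⟨rfl, {g}, Finset.singleton_nonempty g, fun h hh => ?_, sameOrbit.refl _ _⟩
    rw [Finset.mem_singleton.mp hh]
    exact le_trans (by norm_num) hg
  symm := by
    rintro p q ⟨hpq, S, hS, hle, horb⟩
    exact ⟨hpq.symm, S, hS, hpq ▸ hle, horb.symm⟩
  trans := by
    rintro p q r ⟨hpq, S, hS, hleS, horbS⟩ ⟨hqr, T, -, hleT, horbT⟩
    refine ⟨hpq.trans hqr, S ∪ T, hS.mono Finset.subset_union_left, fun g hg => ?_,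
      (horbS.mono (groupOf_mono Finset.subset_union_left)).trans
        (horbT.mono (groupOf_mono Finset.subset_union_right))⟩
    rcases Finset.mem_union.mp hg with h | h
    · exact hleS g h
    · exact hpq ▸ hleT g h

theorem isClosed_setOf_simRel :
    IsClosed {pq : (↥(skel 4 2) × Fin 4) × (↥(skel 4 2) × Fin 4) | SimRel pq.1 pq.2} := by
  simp only [SimRel, Set.ofPred_and, Set.ofPred_exists]
  refine (isClosed_eq (by fun_prop) (by fun_prop)).inter
    (isClosed_iUnion_of_finite fun S => isClosed_const.inter (IsClosed.inter ?_ ?_))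
  · simp only [Set.ofPred_forall]
    exact isClosed_iInter fun g => isClosed_iInter fun _ =>
      isClosed_le continuous_const
        ((continuous_apply g).comp (continuous_subtype_val.comp (by fun_prop)))
  · exact (isClosed_discrete {ij : Fin 4 × Fin 4 | sameOrbit (groupOf S) ij.1 ij.2}).preimage
      (f := fun pq : (↥(skel 4 2) × Fin 4) × (↥(skel 4 2) × Fin 4) => (pq.1.2, pq.2.2))
      (by fun_prop)

/-- the relation `∼` is an equivalence relation on
`Δ^{S₄}_{(2)} × {1,2,3,4}`, and its graph is closed. -/
theorem simRel_equivalence_and_closed :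
    Equivalence SimRel ∧
    IsClosed {pq : (↥(skel 4 2) × Fin 4) × (↥(skel 4 2) × Fin 4) | SimRel pq.1 pq.2} :=
  ⟨simRel_equivalence, isClosed_setOf_simRel⟩
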